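/- Let (Ω,𝔉,ℙ) be a probability space, T>0, C>0, and let c:[0,T]×ℝ^d×ℝ^l→ℝ^{1×l} be continuous with |c(t,x,ξ)| ≤ C(1+|x|+|ξ|) for all (t,x,ξ). For each n∈ℕ let (X̄^n, ξ̄^n, r̄^n) and (X̄, ξ̄, r̄) be measurable maps from Ω into C([0,1]; ℝ^d×ℝ^l×[0,T]) such that almost surely every component of ξ̄^n and of ξ̄ is non-decreasing. Assume (a) (X̄^n, ξ̄^n, r̄^n) → (X̄, ξ̄, r̄) uniformly on [0,1], ℙ-almost surely, and (b) the family ( sup_{u∈[0,1]}|X̄^n_u|² + sup_{u∈[0,1]}|ξ̄^n_u|² )_{n∈ℕ} is uniformly integrable. Then E[ ∫₀^1 c(r̄^n_u, X̄^n_u, ξ̄^n_u) dξ̄^n_u ] → E[ ∫₀^1 c(r̄_u, X̄_u, ξ̄_u) dξ̄_u ] as n→∞. -/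

import Mathlib

open Set Filter MeasureTheory Topology

/-- Euclidean norm on `ι → ℝ`. -/
noncomputable def eucNorm {ι : Type*} [Fintype ι] (a : ι → ℝ) : ℝ :=
  Real.sqrt (∑ i, a i ^ 2)

/-- `μ` is the Lebesgue–Stieltjes measure on `[0,1]` of the (continuous, non-decreasing)
function `z`. -/
def IsLSMeasureOn01 (z : ℝ → ℝ) (μ : Measure ℝ) : Prop :=
  (∀ a b : ℝ, 0 ≤ a → a ≤ b → b ≤ 1 → μ (Set.Icc a b) = ENNReal.ofReal (z b - z a)) ∧
  μ (Set.Icc (0:ℝ) 1)ᶜ = 0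

section LebesgueStieltjes

variable {z : ℝ → ℝ} {μ : Measure ℝ}

lemma IsLSMeasureOn01.isFiniteMeasure (h : IsLSMeasureOn01 z μ) : IsFiniteMeasure μ := by
  refine ⟨?_⟩
  rw [← Set.union_compl_self (Icc (0:ℝ) 1)]
  refine (measure_union_le _ _).trans_lt ?_
  rw [h.2, h.1 0 1 le_rfl zero_le_one le_rfl, add_zero]
  exact ENNReal.ofReal_lt_top

lemma IsLSMeasureOn01.measure_singleton (h : IsLSMeasureOn01 z μ) {a : ℝ}
    (ha : a ∈ Icc (0:ℝ) 1) : μ {a} = 0 := by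
  simpa using h.1 a a ha.1 le_rfl ha.2

lemma IsLSMeasureOn01.real_Ioc (h : IsLSMeasureOn01 z μ) (hz : MonotoneOn z (Icc 0 1))
    {a b : ℝ} (ha : 0 ≤ a) (hab : a ≤ b) (hb : b ≤ 1) : μ.real (Ioc a b) = z b - z a := by
  have hIoc : μ (Ioc a b) = μ (Icc a b) := by
    exact measure_congr (Ioc_ae_eq_Icc' (h.measure_singleton ⟨ha, hab.trans hb⟩))
  rw [measureReal_def, hIoc, h.1 a b ha hab hb, ENNReal.toReal_ofReal]
  exact sub_nonneg.2 (hz ⟨ha, hab.trans hb⟩ ⟨ha.trans hab, hb⟩ hab)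

/-- Distance between a Stieltjes integral and a Riemann–Stieltjes sum whose values are
`δ`-close to the integrand. -/
lemma IsLSMeasureOn01.abs_setIntegral_sub_sum_le (h : IsLSMeasureOn01 z μ)
    (hz : MonotoneOn z (Icc 0 1)) {f : ℝ → ℝ} (hf : ContinuousOn f (Icc 0 1))
    {p : ℕ → ℝ} (hp : Monotone p) {N : ℕ} (hp0 : p 0 = 0) (hpN : p N = 1) {a : ℕ → ℝ} {δ : ℝ}
    (hδ : ∀ k < N, ∀ u ∈ Icc (p k) (p (k + 1)), |f u - a k| ≤ δ) :
    |(∫ u in Icc (0:ℝ) 1, f u ∂μ) - ∑ k ∈ Finset.range N, a k * (z (p (k + 1)) - z (p k))|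
      ≤ δ * (z 1 - z 0) := by
  have := h.isFiniteMeasure
  have hmem : ∀ k ≤ N, p k ∈ Icc (0:ℝ) 1 := fun k hk =>
    ⟨hp0 ▸ hp (Nat.zero_le k), hpN ▸ hp hk⟩
  have hfi : IntegrableOn f (Icc 0 1) μ := hf.integrableOn_compact isCompact_Icc
  have hsub : ∀ k < N, Ioc (p k) (p (k + 1)) ⊆ Icc 0 1 := fun k hk u hu =>
    ⟨(hmem k hk.le).1.trans hu.1.le, hu.2.trans (hmem (k + 1) hk).2⟩
  have hint : ∀ k < N, IntervalIntegrable f μ (p k) (p (k + 1)) := fun k hk =>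
    (intervalIntegrable_iff_integrableOn_Ioc_of_le (hp k.le_succ)).2 (hfi.mono_set (hsub k hk))
  have hsum : ∫ u in Icc (0:ℝ) 1, f u ∂μ
      = ∑ k ∈ Finset.range N, ∫ u in Ioc (p k) (p (k + 1)), f u ∂μ := by
    rw [integral_Icc_eq_integral_Ioc' (h.measure_singleton ⟨le_rfl, zero_le_one⟩),
      ← intervalIntegral.integral_of_le zero_le_one, ← hp0, ← hpN,
      ← intervalIntegral.sum_integral_adjacent_intervals hint]
    exact Finset.sum_congr rfl fun k _ => intervalIntegral.integral_of_le (hp k.le_succ)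
  have htel : z 1 - z 0 = ∑ k ∈ Finset.range N, (z (p (k + 1)) - z (p k)) := by
    rw [Finset.sum_range_sub (fun k => z (p k)), hp0, hpN]
  rw [hsum, ← Finset.sum_sub_distrib, htel, Finset.mul_sum]
  refine (Finset.abs_sum_le_sum_abs _ _).trans (Finset.sum_le_sum fun k hk => ?_)
  have hk : k < N := Finset.mem_range.1 hk
  have hreal := h.real_Ioc hz (hmem k hk.le).1 (hp k.le_succ) (hmem (k + 1) hk).2
  have hconst : a k * (z (p (k + 1)) - z (p k)) = ∫ _ in Ioc (p k) (p (k + 1)), a k ∂μ := by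
    rw [setIntegral_const, hreal, smul_eq_mul, mul_comm]
  rw [hconst, ← integral_sub (hfi.mono_set (hsub k hk)) (integrable_const _), ← hreal]
  exact norm_setIntegral_le_of_norm_le_const (f := fun u => f u - a k) (measure_lt_top _ _)
    fun u hu => hδ k hk u (Ioc_subset_Icc_self hu)

/-- Stieltjes integrals converge when the integrands converge uniformly and the integrators
converge pointwise. -/
lemma tendsto_setIntegral_of_isLSMeasureOn01 {ζ : ℕ → ℝ → ℝ} {ν : ℕ → Measure ℝ}
    (hν : ∀ n, IsLSMeasureOn01 (ζ n) (ν n)) (hζ : ∀ n, MonotoneOn (ζ n) (Icc 0 1))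
    (hμ : IsLSMeasureOn01 z μ) (hz : MonotoneOn z (Icc 0 1))
    (hlim : ∀ u ∈ Icc (0:ℝ) 1, Tendsto (fun n => ζ n u) atTop (𝓝 (z u)))
    {f : ℕ → ℝ → ℝ} {g : ℝ → ℝ} (hf : ∀ n, ContinuousOn (f n) (Icc 0 1))
    (hg : ContinuousOn g (Icc 0 1)) (hfg : TendstoUniformlyOn f g atTop (Icc 0 1)) :
    Tendsto (fun n => ∫ u in Icc (0:ℝ) 1, f n u ∂(ν n)) atTop
      (𝓝 (∫ u in Icc (0:ℝ) 1, g u ∂μ)) := by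
  have h0 : (0:ℝ) ∈ Icc (0:ℝ) 1 := ⟨le_rfl, zero_le_one⟩
  have h1 : (1:ℝ) ∈ Icc (0:ℝ) 1 := ⟨zero_le_one, le_rfl⟩
  set V := z 1 - z 0
  have hV : 0 ≤ V := sub_nonneg.2 (hz h0 h1 zero_le_one)
  rw [Metric.tendsto_atTop']
  intro ε hε
  obtain ⟨δ, hδ, hδε⟩ : ∃ δ > 0, 2 * δ * (V + 1) + δ + δ * V < ε := by
    refine ⟨ε / (2 * (3 * V + 3)), by positivity, ?_⟩
    have : ε / (2 * (3 * V + 3)) * (2 * (3 * V + 3)) = ε := by field_simp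
    linarith
  obtain ⟨η, hη, hgη⟩ := Metric.uniformContinuousOn_iff.1
    (isCompact_Icc.uniformContinuousOn_of_continuous hg) δ hδ
  obtain ⟨m, hm⟩ := exists_nat_one_div_lt hη
  set N := m + 1 with hN
  have hNpos : (0:ℝ) < N := by positivity
  set p : ℕ → ℝ := fun k => k / N with hp_def
  have hp : Monotone p := fun i j hij => by
    simp only [hp_def]; gcongr
  have hp0 : p 0 = 0 := by simp [hp_def]
  have hpN : p N = 1 := div_self hNpos.ne'
  have hmem : ∀ k ≤ N, p k ∈ Icc (0:ℝ) 1 := fun k hk =>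
    ⟨hp0 ▸ hp (Nat.zero_le k), hpN ▸ hp hk⟩
  have hstep : ∀ k, p (k + 1) - p k < η := fun k => by
    have : p (k + 1) - p k = 1 / ((m:ℝ) + 1) := by
      simp only [hp_def, hN]; push_cast; ring
    rwa [this]
  have hmem' : ∀ k < N, ∀ u ∈ Icc (p k) (p (k + 1)), u ∈ Icc (0:ℝ) 1 := fun k hk u hu =>
    ⟨(hmem k hk.le).1.trans hu.1, hu.2.trans (hmem (k + 1) hk).2⟩
  have hosc : ∀ k < N, ∀ u ∈ Icc (p k) (p (k + 1)), |g u - g (p k)| ≤ δ := fun k hk u hu => by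
    refine (hgη u (hmem' k hk u hu) (p k) (hmem k hk.le) ?_).le
    rw [Real.dist_eq, abs_of_nonneg (sub_nonneg.2 hu.1)]
    exact (sub_le_sub_right hu.2 _).trans_lt (hstep k)
  have hS : Tendsto
      (fun n => ∑ k ∈ Finset.range N, g (p k) * (ζ n (p (k + 1)) - ζ n (p k))) atTop
      (𝓝 (∑ k ∈ Finset.range N, g (p k) * (z (p (k + 1)) - z (p k)))) := by
    refine tendsto_finsetSum _ fun k hk => ?_
    have hk := Finset.mem_range.1 hk
    exact ((hlim _ (hmem (k + 1) hk)).sub (hlim _ (hmem k hk.le))).const_mul _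
  have hVn : ∀ᶠ n in atTop, ζ n 1 - ζ n 0 < V + 1 :=
    ((hlim 1 h1).sub (hlim 0 h0)).eventually_lt_const (lt_add_one V)
  have hSn := Metric.tendsto_nhds.1 hS δ hδ
  have hfn := Metric.tendstoUniformlyOn_iff.1 hfg δ hδ
  obtain ⟨n₀, hn₀⟩ := eventually_atTop.1 (hVn.and (hSn.and hfn))
  refine ⟨n₀, fun n hn => ?_⟩
  obtain ⟨hv, hs, hu⟩ := hn₀ n hn.le
  have e1 := hμ.abs_setIntegral_sub_sum_le hz hg hp hp0 hpN hosc
  have e2 := (hν n).abs_setIntegral_sub_sum_le (hζ n) (hf n) hp hp0 hpN (a := fun k => g (p k))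
    (δ := 2 * δ) (fun k hk u hku => by
      have e3 := hu u (hmem' k hk u hku)
      rw [Real.dist_eq, abs_lt] at e3
      have e4 := abs_le.1 (hosc k hk u hku)
      exact abs_le.2 ⟨by linarith, by linarith⟩)
  have e5 : 2 * δ * (ζ n 1 - ζ n 0) ≤ 2 * δ * (V + 1) := by gcongr
  rw [Real.dist_eq, abs_lt] at hs ⊢
  rw [abs_le] at e1 e2
  constructor <;> linarith

end LebesgueStieltjes

/-- Postcomposition with a map that is continuous on `s × univ` preserves uniform convergence to
a function with compact image. -/
lemma TendstoUniformlyOn.comp_continuousOn_of_isCompact {α β γ : Type*} [TopologicalSpace α]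
    [UniformSpace β] [UniformSpace γ] {K : Set α} (hK : IsCompact K) {s : Set β}
    {G : β → γ} (hG : ContinuousOn G s) {g : ℕ → α → β} {g' : α → β}
    (hg' : ContinuousOn g' K) (hs : ∀ n, MapsTo (g n) K s) (hs' : MapsTo g' K s)
    (h : TendstoUniformlyOn g g' atTop K) :
    TendstoUniformlyOn (fun n u => G (g n u)) (fun u => G (g' u)) atTop K := by
  intro V hV
  have hc : IsCompact ((fun u : K => (⟨g' u, hs' u.2⟩ : s)) '' univ) := by
    have := isCompact_iff_compactSpace.1 hK
    exact isCompact_univ.image (hg'.domRestrict.subtype_mk _)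
  have hmem := hc.uniformContinuousAt_of_continuousAt (f := s.domRestrict G) (r := V)
    (fun x _ => (continuousOn_iff_continuous_domRestrict.1 hG).continuousAt) hV
  rw [uniformity_subtype, mem_comap] at hmem
  obtain ⟨W, hW, hWV⟩ := hmem
  filter_upwards [h W hW] with n hn u hu
  exact hWV (a := (⟨g' u, hs' hu⟩, ⟨g n u, hs n hu⟩)) (hn u hu) ⟨⟨u, hu⟩, mem_univ _, rfl⟩

section EucNorm

variable {ι : Type*} [Fintype ι]

lemma continuous_eucNorm : Continuous (eucNorm : (ι → ℝ) → ℝ) := by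
  unfold eucNorm; fun_prop

lemma abs_le_eucNorm (a : ι → ℝ) (i : ι) : |a i| ≤ eucNorm a :=
  Real.abs_le_sqrt (Finset.single_le_sum (f := fun i => a i ^ 2)
    (fun j _ => sq_nonneg (a j)) (Finset.mem_univ i))

lemma iSup_eucNorm_sq_nonneg (f : ℝ → ι → ℝ) :
    0 ≤ ⨆ u : Icc (0:ℝ) 1, eucNorm (f u.1) ^ 2 :=
  Real.iSup_nonneg fun _ => sq_nonneg _

lemma eucNorm_le_sqrt_iSup {f : ℝ → ι → ℝ} (hf : ContinuousOn f (Icc 0 1)) {u : ℝ}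
    (hu : u ∈ Icc (0:ℝ) 1) :
    eucNorm (f u) ≤ √(⨆ u : Icc (0:ℝ) 1, eucNorm (f u.1) ^ 2) := by
  have hbdd : BddAbove (range fun u : Icc (0:ℝ) 1 => eucNorm (f u.1) ^ 2) := by
    have hc : Continuous fun u : Icc (0:ℝ) 1 => eucNorm (f u.1) ^ 2 :=
      (continuous_eucNorm.comp hf.domRestrict).pow 2
    exact (isCompact_range hc).bddAbove
  exact Real.le_sqrt_of_sq_le (le_ciSup hbdd ⟨u, hu⟩)

end EucNorm

/-- A Stieltjes integral whose integrand has linear growth in the integrator and in an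
auxiliary path grows at most quadratically. -/
lemma abs_sum_setIntegral_le {d l : ℕ} {C : ℝ} (hC : 0 < C) {x : ℝ → Fin d → ℝ}
    {ζ : ℝ → Fin l → ℝ} {f : ℝ → Fin l → ℝ} {ν : Fin l → Measure ℝ}
    (hx : ContinuousOn x (Icc 0 1)) (hζ : ContinuousOn ζ (Icc 0 1))
    (hmono : ∀ j, MonotoneOn (fun u => ζ u j) (Icc 0 1))
    (hν : ∀ j, IsLSMeasureOn01 (fun u => ζ u j) (ν j))
    (hf : ∀ u ∈ Icc (0:ℝ) 1, eucNorm (f u) ≤ C * (1 + eucNorm (x u) + eucNorm (ζ u))) :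
    |∑ j, ∫ u in Icc (0:ℝ) 1, f u j ∂(ν j)| ≤ (l * C * 4) *
      (1 + ((⨆ u : Icc (0:ℝ) 1, eucNorm (x u.1) ^ 2) +
        ⨆ u : Icc (0:ℝ) 1, eucNorm (ζ u.1) ^ 2)) := by
  have h0 : (0:ℝ) ∈ Icc (0:ℝ) 1 := ⟨le_rfl, zero_le_one⟩
  have h1 : (1:ℝ) ∈ Icc (0:ℝ) 1 := ⟨zero_le_one, le_rfl⟩
  set A := √(⨆ u : Icc (0:ℝ) 1, eucNorm (x u.1) ^ 2) with hA
  set B := √(⨆ u : Icc (0:ℝ) 1, eucNorm (ζ u.1) ^ 2) with hB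
  rw [← Real.sq_sqrt (iSup_eucNorm_sq_nonneg x), ← Real.sq_sqrt (iSup_eucNorm_sq_nonneg ζ),
    ← hA, ← hB]
  have hA0 : 0 ≤ A := Real.sqrt_nonneg _
  have hB0 : 0 ≤ B := Real.sqrt_nonneg _
  have hterm : ∀ j, |∫ u in Icc (0:ℝ) 1, f u j ∂(ν j)| ≤ C * (1 + A + B) * (2 * B) := by
    intro j
    have := (hν j).isFiniteMeasure
    have hreal : (ν j).real (Icc 0 1) = ζ 1 j - ζ 0 j := by
      rw [measureReal_def, (hν j).1 0 1 le_rfl zero_le_one le_rfl, ENNReal.toReal_ofReal]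
      exact sub_nonneg.2 (hmono j h0 h1 zero_le_one)
    have e1 := (abs_le.1 ((abs_le_eucNorm (ζ 1) j).trans (eucNorm_le_sqrt_iSup hζ h1))).2
    have e2 := (abs_le.1 ((abs_le_eucNorm (ζ 0) j).trans (eucNorm_le_sqrt_iSup hζ h0))).1
    refine (norm_setIntegral_le_of_norm_le_const (f := fun u => f u j) (measure_lt_top (ν j) (Icc 0 1))
      (C := C * (1 + A + B)) (fun u hu => ?_)).trans ?_
    · refine (abs_le_eucNorm (f u) j).trans ((hf u hu).trans ?_)
      gcongr
      · exact eucNorm_le_sqrt_iSup hx hu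
      · exact eucNorm_le_sqrt_iSup hζ hu
    · rw [hreal]
      gcongr
      linarith
  calc |∑ j, ∫ u in Icc (0:ℝ) 1, f u j ∂(ν j)|
      ≤ ∑ _j : Fin l, C * (1 + A + B) * (2 * B) :=
        (Finset.abs_sum_le_sum_abs _ _).trans (Finset.sum_le_sum fun j _ => hterm j)
    _ = (l * C) * ((1 + A + B) * (2 * B)) := by
        rw [Finset.sum_const, Finset.card_univ, Fintype.card_fin, nsmul_eq_mul]; ring
    _ ≤ (l * C) * (4 * (1 + (A ^ 2 + B ^ 2))) := by
        refine mul_le_mul_of_nonneg_left ?_ (by positivity)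
        nlinarith [sq_nonneg (A - B), sq_nonneg (1 - B), sq_nonneg A]
    _ = _ := by ring

lemma MeasureTheory.UnifIntegrable.of_abs_le_mul_one_add {Ω : Type*} [MeasurableSpace Ω]
    {P : Measure Ω} [IsFiniteMeasure P] {F G : ℕ → Ω → ℝ} {K : ℝ}
    (hGm : ∀ n, AEStronglyMeasurable (G n) P) (hG : UnifIntegrable G 1 P)
    (hFG : ∀ n, ∀ᵐ ω ∂P, |F n ω| ≤ K * (1 + G n ω)) : UnifIntegrable F 1 P := by
  have hone : UnifIntegrable (fun (_ : ℕ) (_ : Ω) => (1:ℝ)) 1 P :=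
    unifIntegrable_const le_rfl ENNReal.one_ne_top (memLp_const 1)
  have hsum := hone.add hG le_rfl (fun _ => aestronglyMeasurable_const) hGm
  intro ε hε
  obtain ⟨δ, hδ, h⟩ := hsum (ε := ε / (|K| + 1)) (by positivity)
  refine ⟨δ, hδ, fun n s hs hPs => ?_⟩
  have hle : eLpNorm (s.indicator (F n)) 1 P ≤ ENNReal.ofReal (|K| + 1) *
      eLpNorm (s.indicator ((fun _ => (1:ℝ)) + G n)) 1 P := by
    refine eLpNorm_le_mul_eLpNorm_of_ae_le_mul ?_ 1
    filter_upwards [hFG n] with ω hω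
    by_cases hωs : ω ∈ s
    · simp only [indicator_of_mem hωs, Pi.add_apply, Real.norm_eq_abs]
      refine hω.trans ((le_abs_self _).trans ?_)
      rw [abs_mul]
      gcongr
      linarith
    · simp [indicator_of_notMem hωs]
  refine hle.trans ((mul_le_mul_right (h n s hs hPs) _).trans ?_)
  rw [← ENNReal.ofReal_mul (by positivity), mul_div_cancel₀ _ (by positivity)]

/-- convergence of the expected singular cost term
`E[∫₀¹ c(r̄ⁿ_u, X̄ⁿ_u, ξ̄ⁿ_u) dξ̄ⁿ_u]`. -/
theorem stmt11 {Ω : Type*} [MeasurableSpace Ω] (P : Measure Ω) [IsProbabilityMeasure P]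
    (T C : ℝ) (hT : 0 < T) (hC : 0 < C) (d l : ℕ)
    (c : ℝ → (Fin d → ℝ) → (Fin l → ℝ) → Fin l → ℝ)
    (hc_cont : ContinuousOn (fun q : ℝ × (Fin d → ℝ) × (Fin l → ℝ) => c q.1 q.2.1 q.2.2)
      (Set.Icc 0 T ×ˢ (Set.univ : Set ((Fin d → ℝ) × (Fin l → ℝ)))))
    (hc_growth : ∀ t ∈ Set.Icc (0:ℝ) T, ∀ x ξv,
      eucNorm (c t x ξv) ≤ C * (1 + eucNorm x + eucNorm ξv))
    (X : ℕ → Ω → ℝ → Fin d → ℝ) (ξ : ℕ → Ω → ℝ → Fin l → ℝ) (r : ℕ → Ω → ℝ → ℝ)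
    (X' : Ω → ℝ → Fin d → ℝ) (ξ' : Ω → ℝ → Fin l → ℝ) (r' : Ω → ℝ → ℝ)
    (hcont : ∀ n ω, ContinuousOn (X n ω) (Set.Icc 0 1) ∧ ContinuousOn (ξ n ω) (Set.Icc 0 1) ∧
      ContinuousOn (r n ω) (Set.Icc 0 1))
    (hcont' : ∀ ω, ContinuousOn (X' ω) (Set.Icc 0 1) ∧ ContinuousOn (ξ' ω) (Set.Icc 0 1) ∧
      ContinuousOn (r' ω) (Set.Icc 0 1))
    (hrT : ∀ n ω, ∀ u ∈ Set.Icc (0:ℝ) 1, r n ω u ∈ Set.Icc 0 T)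
    (hrT' : ∀ ω, ∀ u ∈ Set.Icc (0:ℝ) 1, r' ω u ∈ Set.Icc 0 T)
    (hmono : ∀ᵐ ω ∂P, (∀ n j, MonotoneOn (fun u => ξ n ω u j) (Set.Icc 0 1)) ∧
      ∀ j, MonotoneOn (fun u => ξ' ω u j) (Set.Icc 0 1))
    (μ : ℕ → Ω → Fin l → Measure ℝ) (μ' : Ω → Fin l → Measure ℝ)
    (hμ : ∀ n ω j, IsLSMeasureOn01 (fun u => ξ n ω u j) (μ n ω j))
    (hμ' : ∀ ω j, IsLSMeasureOn01 (fun u => ξ' ω u j) (μ' ω j))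
    -- (a) almost sure uniform convergence on [0,1]
    (hconv : ∀ᵐ ω ∂P, TendstoUniformlyOn (fun n u => (X n ω u, ξ n ω u, r n ω u))
      (fun u => (X' ω u, ξ' ω u, r' ω u)) atTop (Set.Icc 0 1))
    -- (b) uniform integrability
    (hUI : UniformIntegrable (fun n ω =>
      (⨆ u : Set.Icc (0:ℝ) 1, eucNorm (X n ω u.1) ^ 2) +
        ⨆ u : Set.Icc (0:ℝ) 1, eucNorm (ξ n ω u.1) ^ 2) 1 P)
    (hint : ∀ n, Integrable (fun ω =>
      ∑ j, ∫ u in Set.Icc (0:ℝ) 1, c (r n ω u) (X n ω u) (ξ n ω u) j ∂(μ n ω j)) P)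
    (hint' : Integrable (fun ω =>
      ∑ j, ∫ u in Set.Icc (0:ℝ) 1, c (r' ω u) (X' ω u) (ξ' ω u) j ∂(μ' ω j)) P) :
    Tendsto (fun n => ∫ ω,
        (∑ j, ∫ u in Set.Icc (0:ℝ) 1, c (r n ω u) (X n ω u) (ξ n ω u) j ∂(μ n ω j)) ∂P)
      atTop (𝓝 (∫ ω,
        (∑ j, ∫ u in Set.Icc (0:ℝ) 1, c (r' ω u) (X' ω u) (ξ' ω u) j ∂(μ' ω j)) ∂P)) := by
  have hbound : ∀ n, ∀ᵐ ω ∂P,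
      |∑ j, ∫ u in Set.Icc (0:ℝ) 1, c (r n ω u) (X n ω u) (ξ n ω u) j ∂(μ n ω j)| ≤
        (l * C * 4) * (1 + ((⨆ u : Set.Icc (0:ℝ) 1, eucNorm (X n ω u.1) ^ 2) +
          ⨆ u : Set.Icc (0:ℝ) 1, eucNorm (ξ n ω u.1) ^ 2)) := fun n => by
    filter_upwards [hmono] with ω hω
    exact abs_sum_setIntegral_le hC (hcont n ω).1 (hcont n ω).2.1 (hω.1 n) (hμ n ω)
      fun u hu => hc_growth _ (hrT n ω u hu) _ _
  have hlim : ∀ᵐ ω ∂P, Tendsto (fun n =>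
      ∑ j, ∫ u in Set.Icc (0:ℝ) 1, c (r n ω u) (X n ω u) (ξ n ω u) j ∂(μ n ω j)) atTop
      (𝓝 (∑ j, ∫ u in Set.Icc (0:ℝ) 1, c (r' ω u) (X' ω u) (ξ' ω u) j ∂(μ' ω j))) := by
    filter_upwards [hmono, hconv] with ω hω hωc
    have hpath : ∀ n, ContinuousOn (fun u => (r n ω u, X n ω u, ξ n ω u)) (Icc 0 1) :=
      fun n => (hcont n ω).2.2.prodMk ((hcont n ω).1.prodMk (hcont n ω).2.1)
    have hpath' : ContinuousOn (fun u => (r' ω u, X' ω u, ξ' ω u)) (Icc 0 1) :=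
      (hcont' ω).2.2.prodMk ((hcont' ω).1.prodMk (hcont' ω).2.1)
    have hmaps : ∀ n, MapsTo (fun u => (r n ω u, X n ω u, ξ n ω u)) (Icc 0 1)
        (Icc 0 T ×ˢ univ) := fun n u hu => ⟨hrT n ω u hu, mem_univ _⟩
    have hmaps' : MapsTo (fun u => (r' ω u, X' ω u, ξ' ω u)) (Icc 0 1)
        (Icc 0 T ×ˢ univ) := fun u hu => ⟨hrT' ω u hu, mem_univ _⟩
    have hrot : UniformContinuous
        (fun q : (Fin d → ℝ) × (Fin l → ℝ) × ℝ => (q.2.2, q.1, q.2.1)) :=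
      (uniformContinuous_snd.comp uniformContinuous_snd).prodMk
        (uniformContinuous_fst.prodMk (uniformContinuous_fst.comp uniformContinuous_snd))
    have hunif : TendstoUniformlyOn (fun n u => c (r n ω u) (X n ω u) (ξ n ω u))
        (fun u => c (r' ω u) (X' ω u) (ξ' ω u)) atTop (Icc 0 1) :=
      TendstoUniformlyOn.comp_continuousOn_of_isCompact isCompact_Icc hc_cont hpath' hmaps hmaps'
        (hrot.comp_tendstoUniformlyOn hωc)
    refine tendsto_finsetSum _ fun j _ => ?_
    refine tendsto_setIntegral_of_isLSMeasureOn01 (fun n => hμ n ω j) (fun n => hω.1 n j)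
      (hμ' ω j) (hω.2 j) (fun u hu => ?_)
      (fun n => (continuous_apply j).comp_continuousOn (hc_cont.comp (hpath n) (hmaps n)))
      ((continuous_apply j).comp_continuousOn (hc_cont.comp hpath' hmaps'))
      ((Pi.uniformContinuous_proj _ j).comp_tendstoUniformlyOn hunif)
    have hu' := hωc.tendsto_at hu
    exact ((continuous_apply j).tendsto _).comp
      ((continuous_fst.comp continuous_snd).tendsto _ |>.comp hu')
  have hui := UnifIntegrable.of_abs_le_mul_one_add (fun n => hUI.1 n) hUI.2.1 hbound
  refine tendsto_integral_of_L1' _ hint'.1 (Eventually.of_forall hint) ?_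
  exact tendsto_Lp_finite_of_tendsto_ae le_rfl ENNReal.one_ne_top (fun n => (hint n).1)
    (memLp_one_iff_integrable.2 hint') hui hlim
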